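/- arXiv:1710.09961 — 2 statements merged into one kernel-verified Lean document; each statement's English description precedes it below -/
import Mathlib

section
/- Under the uniform wedge sampling model with sample size k = pm, if Δ ≥ 1 then the relative standard error of ω satisfies RSE(ω) = sqrt( ((1 − C)/(pmC)) · (1 − (pm − 1)/(Λ − 1)) ). -/
open scoped Classical

noncomputable section

/-- `Δ`: the number of triangles (3-cliques) of `G`. -/
def triangleCount {V : Type*} [Fintype V] (G : SimpleGraph V) : ℕ :=
  (G.cliqueFinset 3).card

/-- The wedges of `G`: unordered pairs of distinct edges sharing a vertex, encoded as
2-element subsets of the edge set whose two edges have a common vertex. -/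
def wedgeFinset {V : Type*} [Fintype V] (G : SimpleGraph V) : Finset (Finset (Sym2 V)) :=
  (G.edgeFinset.powersetCard 2).filter (fun P => ∃ v, ∀ e ∈ P, v ∈ e)

/-- A wedge `u-v-w` (with edges `{u,v}` and `{v,w}`) is closed if `{u,w}` is an edge of `G`. -/
def IsClosedWedge {V : Type*} (G : SimpleGraph V) (P : Finset (Sym2 V)) : Prop :=
  ∃ u v w, P = {s(u, v), s(v, w)} ∧ G.Adj u w

/-- `ω(S)`: the number of closed wedges belonging to the sample `S`. -/
def closedCount {V : Type*} (G : SimpleGraph V) (S : Finset (Finset (Sym2 V))) : ℕ :=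
  (S.filter (IsClosedWedge G)).card

/-- the expectation of a function of a uniformly random `k`-element subset of
the set of wedges of `G`. -/
def wexp {V : Type*} [Fintype V] (G : SimpleGraph V) (k : ℕ)
    (f : Finset (Finset (Sym2 V)) → ℝ) : ℝ :=
  (∑ S ∈ (wedgeFinset G).powersetCard k, f S) /
    (((wedgeFinset G).powersetCard k).card : ℝ)

/-- Closed wedges of `G`. -/
def closedWedgeFinset {V : Type*} [Fintype V] (G : SimpleGraph V) : Finset (Finset (Sym2 V)) :=
  (wedgeFinset G).filter (IsClosedWedge G)

theorem mem_closedWedgeFinset {V : Type*} [Fintype V] {G : SimpleGraph V} {P : Finset (Sym2 V)} :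
    P ∈ closedWedgeFinset G ↔
      ∃ u v w, G.Adj u v ∧ G.Adj v w ∧ G.Adj u w ∧ P = {s(u, v), s(v, w)} := by
  simp only [closedWedgeFinset, wedgeFinset, Finset.mem_filter, Finset.mem_powersetCard,
    IsClosedWedge]
  constructor
  · rintro ⟨⟨⟨hsub, -⟩, -⟩, u, v, w, rfl, huw⟩
    have huv : s(u, v) ∈ G.edgeFinset := hsub (by simp)
    have hvw : s(v, w) ∈ G.edgeFinset := hsub (by simp)
    exact ⟨u, v, w, by simpa using huv, by simpa using hvw, huw, rfl⟩
  · rintro ⟨u, v, w, huv, hvw, huw, rfl⟩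
    refine ⟨⟨⟨?_, ?_⟩, v, by simp⟩, u, v, w, rfl, huw⟩
    · simp [Finset.insert_subset_iff, huv, hvw]
    · rw [Finset.card_pair]
      have := huw.ne
      have := huv.ne
      simp only [ne_eq, Sym2.eq_iff]
      tauto

/-- Every triangle contains exactly three closed wedges. -/
theorem card_closedWedgeFinset {V : Type*} [Fintype V] (G : SimpleGraph V) :
    (closedWedgeFinset G).card = 3 * triangleCount G := by
  have support_pair (u v w : V) :
      ({s(u, v), s(v, w)} : Finset (Sym2 V)).biUnion Sym2.toFinset = {u, v, w} := by
    ext x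
    simp
    tauto
  rw [Finset.card_eq_sum_card_fiberwise (f := fun P => P.biUnion Sym2.toFinset)
    (t := G.cliqueFinset 3), triangleCount, mul_comm, ← smul_eq_mul]
  · refine Finset.sum_const_nat fun T hT => ?_
    obtain ⟨a, b, c, hab, hac, hbc, rfl⟩ :=
      SimpleGraph.is3Clique_iff.1 (G.mem_cliqueFinset_iff.1 hT)
    have nab := hab.ne
    have nac := hac.ne
    have nbc := hbc.ne
    refine Finset.card_eq_three.2 ⟨{s(a, b), s(b, c)}, {s(b, a), s(a, c)}, {s(a, c), s(c, b)},
      ?_, ?_, ?_, ?_⟩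
    · intro h
      have : s(b, c) ∈ ({s(b, a), s(a, c)} : Finset (Sym2 V)) := by simp [← h]
      simp at this
      grind
    · intro h
      have : s(a, b) ∈ ({s(a, c), s(c, b)} : Finset (Sym2 V)) := by simp [← h]
      simp at this
      grind
    · intro h
      have : s(b, a) ∈ ({s(a, c), s(c, b)} : Finset (Sym2 V)) := by simp [← h]
      simp at this
      grind
    · ext P
      simp only [Finset.mem_filter, mem_closedWedgeFinset, Finset.mem_insert,
        Finset.mem_singleton]
      constructor
      · rintro ⟨⟨u, v, w, huv, hvw, huw, rfl⟩, hT⟩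
        rw [support_pair] at hT
        have hu : u ∈ ({a, b, c} : Finset V) := by simp [← hT]
        have hv : v ∈ ({a, b, c} : Finset V) := by simp [← hT]
        have hw : w ∈ ({a, b, c} : Finset V) := by simp [← hT]
        have nuv := huv.ne
        have nvw := hvw.ne
        have nuw := huw.ne
        simp only [Finset.mem_insert, Finset.mem_singleton] at hu hv hw
        clear hT
        rcases hu with rfl | rfl | rfl <;> rcases hv with rfl | rfl | rfl <;>
          rcases hw with rfl | rfl | rfl <;>
          simp_all [Sym2.eq_swap, Finset.pair_comm]
      · rintro (rfl | rfl | rfl)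
        · exact ⟨⟨a, b, c, hab, hbc, hac, rfl⟩, support_pair ..⟩
        · refine ⟨⟨b, a, c, hab.symm, hac, hbc, rfl⟩, ?_⟩
          rw [support_pair, Finset.insert_comm]
        · refine ⟨⟨a, c, b, hac, hbc.symm, hab, rfl⟩, ?_⟩
          rw [support_pair, Finset.pair_comm]
  · intro P hP
    obtain ⟨u, v, w, huv, hvw, huw, rfl⟩ := mem_closedWedgeFinset.1 hP
    simp only [support_pair, Finset.mem_coe, SimpleGraph.mem_cliqueFinset_iff]
    exact SimpleGraph.is3Clique_triple_iff.2 ⟨huv, huw, hvw⟩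

/-- The number of `k`-element subsets of `W` containing a given `T ⊆ W`. -/
theorem card_powersetCard_filter_superset {α : Type*} {W T : Finset α} {k : ℕ} (hT : T ⊆ W)
    (hk : T.card ≤ k) :
    ((W.powersetCard k).filter (T ⊆ ·)).card = (W.card - T.card).choose (k - T.card) := by
  rw [← Finset.card_sdiff_of_subset hT, ← Finset.card_powersetCard]
  refine Finset.card_nbij' (· \ T) (· ∪ T) ?_ ?_ ?_ ?_
  · intro S hS
    simp only [Finset.coe_filter, Finset.mem_powersetCard, Set.mem_ofPred_eq, Finset.mem_coe] at hS ⊢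
    exact ⟨Finset.sdiff_subset_sdiff hS.1.1 subset_rfl,
      by rw [Finset.card_sdiff_of_subset hS.2, hS.1.2]⟩
  · intro S hS
    simp only [Finset.coe_filter, Finset.mem_powersetCard, Set.mem_ofPred_eq, Finset.mem_coe] at hS ⊢
    refine ⟨⟨Finset.union_subset (hS.1.trans Finset.sdiff_subset) hT, ?_⟩,
      Finset.subset_union_right⟩
    rw [Finset.card_union_of_disjoint (Finset.disjoint_of_subset_left hS.1 Finset.sdiff_disjoint),
      hS.2]
    omega
  · intro S hS
    simp only [Finset.coe_filter, Set.mem_ofPred_eq] at hS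
    exact Finset.sdiff_union_of_subset hS.2
  · intro S hS
    simp only [Finset.mem_powersetCard, Finset.mem_coe] at hS
    exact Finset.union_sdiff_cancel_right
      (Finset.disjoint_of_subset_left hS.1 Finset.sdiff_disjoint)

/-- Factorial moments of the hypergeometric distribution, as a counting identity. -/
theorem choose_mul_sum_powersetCard_choose {α : Type*} (W : Finset α) (q : α → Prop)
    (k j : ℕ) :
    W.card.choose j * ∑ S ∈ W.powersetCard k, (S.filter q).card.choose j =
      (W.filter q).card.choose j * (W.card.choose k * k.choose j) := by
  rcases lt_or_ge k j with hj | hj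
  · rw [Nat.choose_eq_zero_of_lt hj, Finset.sum_eq_zero]
    · simp
    · intro S hS
      refine Nat.choose_eq_zero_of_lt ((Finset.card_filter_le _ _).trans_lt ?_)
      rwa [(Finset.mem_powersetCard.1 hS).2]
  · have key : ∑ S ∈ W.powersetCard k, (S.filter q).card.choose j =
        ∑ T ∈ (W.filter q).powersetCard j, ((W.powersetCard k).filter (T ⊆ ·)).card := by
      refine Eq.trans ?_ (Finset.sum_card_bipartiteAbove_eq_sum_card_bipartiteBelow
        (fun S T : Finset α => T ⊆ S))
      refine Finset.sum_congr rfl fun S hS => ?_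
      rw [← Finset.card_powersetCard]
      congr 1
      ext T
      have hSW := (Finset.mem_powersetCard.1 hS).1
      simp only [Finset.bipartiteAbove, Finset.mem_filter, Finset.mem_powersetCard,
        Finset.subset_iff] at hSW ⊢
      grind
    have fiber (T) (hT : T ∈ (W.filter q).powersetCard j) :
        ((W.powersetCard k).filter (T ⊆ ·)).card = (W.card - j).choose (k - j) := by
      obtain ⟨hTW, rfl⟩ := Finset.mem_powersetCard.1 hT
      exact card_powersetCard_filter_superset (hTW.trans (Finset.filter_subset _ _)) hj
    rw [key, Finset.sum_congr rfl fiber, Finset.sum_const, Finset.card_powersetCard, smul_eq_mul,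
      Nat.choose_mul hj]
    ring

theorem wexp_closedCount {V : Type*} [Fintype V] (G : SimpleGraph V) {k : ℕ}
    (hk : k ≤ (wedgeFinset G).card) (hW : 1 ≤ (wedgeFinset G).card) :
    wexp G k (fun S => (closedCount G S : ℝ)) =
      k * (closedWedgeFinset G).card / (wedgeFinset G).card := by
  have h := choose_mul_sum_powersetCard_choose (wedgeFinset G) (IsClosedWedge G) k 1
  simp only [Nat.choose_one_right] at h
  have hc : ((wedgeFinset G).card.choose k : ℝ) ≠ 0 := by
    exact_mod_cast (Nat.choose_pos hk).ne'
  have hN : ((wedgeFinset G).card : ℝ) ≠ 0 := by positivity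
  have h' := congrArg (Nat.cast : ℕ → ℝ) h
  push_cast at h'
  rw [wexp, Finset.card_powersetCard, div_eq_div_iff hc hN]
  simp only [closedCount, closedWedgeFinset]
  linear_combination h'

theorem wexp_closedCount_sq {V : Type*} [Fintype V] (G : SimpleGraph V) {k : ℕ}
    (hk : k ≤ (wedgeFinset G).card) (hW : 2 ≤ (wedgeFinset G).card) :
    wexp G k (fun S => (closedCount G S : ℝ) ^ 2) =
      k * (closedWedgeFinset G).card / (wedgeFinset G).card +
        k * (k - 1) * ((closedWedgeFinset G).card * ((closedWedgeFinset G).card - 1)) /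
          ((wedgeFinset G).card * ((wedgeFinset G).card - 1)) := by
  have h := choose_mul_sum_powersetCard_choose (wedgeFinset G) (IsClosedWedge G) k 2
  have hc : ((wedgeFinset G).card.choose k : ℝ) ≠ 0 := by
    exact_mod_cast (Nat.choose_pos hk).ne'
  have hN : (2 : ℝ) ≤ (wedgeFinset G).card := by exact_mod_cast hW
  have hN0 : ((wedgeFinset G).card : ℝ) * ((wedgeFinset G).card - 1) ≠ 0 := by
    have : (0 : ℝ) < (wedgeFinset G).card - 1 := by linarith
    positivity
  have h' := congrArg (Nat.cast : ℕ → ℝ) h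
  push_cast [Nat.cast_choose_two] at h'
  rw [← Finset.sum_div] at h'
  have split (S) : (closedCount G S : ℝ) ^ 2 =
      closedCount G S + closedCount G S * (closedCount G S - 1) := by ring
  rw [← wexp_closedCount G hk (by omega)]
  simp only [wexp, split, Finset.sum_add_distrib, add_div]
  congr 1
  rw [Finset.card_powersetCard, div_eq_div_iff hc hN0]
  simp only [closedCount, closedWedgeFinset]
  linear_combination 4 * h'

/-- Under the uniform wedge sampling model with sample size `k = pm`,
if `Δ ≥ 1` then `RSE(ω) = sqrt(((1 - C)/(pmC))·(1 - (pm - 1)/(Λ - 1)))`. -/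
theorem wedgesample_rse
    {V : Type*} [Fintype V] (G : SimpleGraph V) (k m : ℕ) (p : ℝ)
    (hm : m = G.edgeFinset.card)
    (hk1 : 1 ≤ k) (hkΛ : k ≤ (wedgeFinset G).card)
    (hkp : (k : ℝ) = p * m)
    (hΛ : 2 ≤ (wedgeFinset G).card)
    (hΔ : 1 ≤ triangleCount G) :
    Real.sqrt (wexp G k (fun S => (closedCount G S : ℝ) ^ 2)
        - (wexp G k (fun S => (closedCount G S : ℝ))) ^ 2)
        / wexp G k (fun S => (closedCount G S : ℝ))
      = Real.sqrt ((1 - (3 * (triangleCount G : ℝ) / ((wedgeFinset G).card : ℝ))) / (p * (m : ℝ) * (3 * (triangleCount G : ℝ) / ((wedgeFinset G).card : ℝ)))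
          * (1 - (p * (m : ℝ) - 1) / (((wedgeFinset G).card : ℝ) - 1))) := by
  have hN : (2 : ℝ) ≤ (wedgeFinset G).card := by exact_mod_cast hΛ
  have hk : (1 : ℝ) ≤ k := by exact_mod_cast hk1
  have hD : (1 : ℝ) ≤ triangleCount G := by exact_mod_cast hΔ
  have hA : ((closedWedgeFinset G).card : ℝ) = 3 * triangleCount G := by
    exact_mod_cast card_closedWedgeFinset G
  rw [wexp_closedCount_sq G hkΛ hΛ, wexp_closedCount G hkΛ (by omega), ← hkp, hA]
  generalize ((wedgeFinset G).card : ℝ) = N at *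
  generalize (triangleCount G : ℝ) = D at *
  generalize (k : ℝ) = K at *
  have hN1 : N - 1 ≠ 0 := by linarith
  have hE : 0 ≤ K * (3 * D) / N := by positivity
  nth_rewrite 3 [← Real.sqrt_sq hE]
  rw [← Real.sqrt_div' _ (sq_nonneg _)]
  congr 1
  field_simp
  ring

end
end

section
/- Under the uniform wedge sampling model, the output ω·Λ/(3k) of the WedgeSample algorithm is an unbiased estimator of the triangle count: E(ω·Λ/(3k)) = Δ. -/
open scoped Classical

noncomputable section

/-- The wedge centred at `v` whose edges join `v` to the other elements of `T`. -/
def wedgeAt {V : Type*} (T : Finset V) (v : V) : Finset (Sym2 V) :=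
  (T.erase v).image (fun w => s(v, w))

lemma wedgeAt_left {V : Type*} {a b c : V} (hab : a ≠ b) (hac : a ≠ c) :
    wedgeAt {a, b, c} a = {s(b, a), s(a, c)} := by
  have h : ({a, b, c} : Finset V).erase a = {b, c} := by
    ext x; simp only [Finset.mem_erase, Finset.mem_insert, Finset.mem_singleton]; grind
  rw [wedgeAt, h, Finset.image_insert, Finset.image_singleton, Sym2.eq_swap]

lemma exists_wedgeAt_eq {V : Type*} {G : SimpleGraph V} {T : Finset V} {v : V}
    (hT : G.IsNClique 3 T) (hv : v ∈ T) :
    ∃ b c, G.Adj v b ∧ G.Adj v c ∧ G.Adj b c ∧ T = {v, b, c} ∧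
      wedgeAt T v = {s(b, v), s(v, c)} := by
  obtain ⟨x, y, z, hxy, hxz, hyz, rfl⟩ := SimpleGraph.is3Clique_iff.1 hT
  have key : ∀ b c, G.Adj v b → G.Adj v c → G.Adj b c → ({x, y, z} : Finset V) = {v, b, c} →
      ∃ b c, G.Adj v b ∧ G.Adj v c ∧ G.Adj b c ∧ ({x, y, z} : Finset V) = {v, b, c} ∧
        wedgeAt {x, y, z} v = {s(b, v), s(v, c)} := fun b c h₁ h₂ h₃ h₄ =>
    ⟨b, c, h₁, h₂, h₃, h₄, by rw [h₄, wedgeAt_left h₁.ne h₂.ne]⟩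
  simp only [Finset.mem_insert, Finset.mem_singleton] at hv
  rcases hv with rfl | rfl | rfl
  · exact key y z hxy hxz hyz rfl
  · exact key x z hxy.symm hyz hxz (Finset.insert_comm _ _ _)
  · refine key x y hxz.symm hyz.symm hxy ?_
    ext t; simp only [Finset.mem_insert, Finset.mem_singleton]; tauto

lemma mem_iff_exists_mem_wedgeAt {V : Type*} {G : SimpleGraph V} {T : Finset V} {v : V}
    (hT : G.IsNClique 3 T) (hv : v ∈ T) (x : V) : x ∈ T ↔ ∃ e ∈ wedgeAt T v, x ∈ e := by
  obtain ⟨b, c, -, -, -, hT', hW⟩ := exists_wedgeAt_eq hT hv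
  rw [hW, hT']
  simp only [Finset.mem_insert, Finset.mem_singleton, exists_eq_or_imp, exists_eq_left,
    Sym2.mem_iff]
  tauto

lemma eq_iff_forall_mem_wedgeAt {V : Type*} {G : SimpleGraph V} {T : Finset V} {v : V}
    (hT : G.IsNClique 3 T) (hv : v ∈ T) (x : V) : x = v ↔ ∀ e ∈ wedgeAt T v, x ∈ e := by
  obtain ⟨b, c, -, -, hbc, -, hW⟩ := exists_wedgeAt_eq hT hv
  rw [hW]
  simp only [Finset.mem_insert, Finset.mem_singleton, forall_eq_or_imp, forall_eq, Sym2.mem_iff]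
  have := hbc.ne
  grind

/-- Every triangle contains exactly three closed wedges, and every closed wedge lies in exactly
one triangle. -/
lemma closedCount_wedgeFinset {V : Type*} [Fintype V] (G : SimpleGraph V) :
    closedCount G (wedgeFinset G) = 3 * triangleCount G := by
  have hcard : ((G.cliqueFinset 3).sigma fun T => T).card = 3 * triangleCount G := by
    rw [Finset.card_sigma, Finset.sum_const_nat (m := 3), triangleCount, mul_comm]
    intro T hT
    exact (SimpleGraph.mem_cliqueFinset_iff.1 hT).card_eq
  rw [← hcard, closedCount, eq_comm]
  refine Finset.card_bij (fun p _ => wedgeAt p.1 p.2) ?_ ?_ ?_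
  · rintro ⟨T, v⟩ h
    simp only [Finset.mem_sigma, SimpleGraph.mem_cliqueFinset_iff] at h
    obtain ⟨b, c, hvb, hvc, hbc, -, hW⟩ := exists_wedgeAt_eq h.1 h.2
    have hne : s(b, v) ≠ s(v, c) := by
      rw [Ne, Sym2.eq_iff]
      have := hbc.ne
      have := hvb.ne
      tauto
    simp only [Finset.mem_filter, wedgeFinset, Finset.mem_powersetCard, hW]
    refine ⟨⟨⟨?_, Finset.card_pair hne⟩, v, by simp⟩, b, v, c, rfl, hbc⟩
    simp [Finset.insert_subset_iff, hvb.symm, hvc]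
  · rintro ⟨T, v⟩ h ⟨T', v'⟩ h' heq
    simp only [Finset.mem_sigma, SimpleGraph.mem_cliqueFinset_iff] at h h'
    dsimp only at heq
    obtain rfl : T = T' := by
      ext x
      rw [mem_iff_exists_mem_wedgeAt h.1 h.2, heq, ← mem_iff_exists_mem_wedgeAt h'.1 h'.2]
    obtain rfl : v = v' := by
      rw [eq_iff_forall_mem_wedgeAt h'.1 h'.2, ← heq, ← eq_iff_forall_mem_wedgeAt h.1 h.2]
    rfl
  · intro P hP
    simp only [Finset.mem_filter, wedgeFinset, Finset.mem_powersetCard] at hP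
    obtain ⟨⟨⟨hsub, -⟩, -⟩, u, v, w, rfl, huw⟩ := hP
    simp only [Finset.insert_subset_iff, Finset.singleton_subset_iff, SimpleGraph.mem_edgeFinset,
      SimpleGraph.mem_edgeSet] at hsub
    refine ⟨⟨{v, u, w}, v⟩, ?_, wedgeAt_left hsub.1.ne.symm hsub.2.ne⟩
    simp only [Finset.mem_sigma, SimpleGraph.mem_cliqueFinset_iff, Finset.mem_insert_self,
      and_true]
    exact SimpleGraph.is3Clique_triple_iff.2 ⟨hsub.1.symm, hsub.2, huw⟩

/-- Each element of `W` satisfying `p` belongs to `(#W - 1).choose (k - 1)` of the `k`-element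
subsets of `W`. -/
lemma sum_card_filter_powersetCard {α : Type*} (W : Finset α) (p : α → Prop) {k : ℕ}
    (hk : 1 ≤ k) :
    ∑ S ∈ W.powersetCard k, (S.filter p).card =
      (W.filter p).card * (W.card - 1).choose (k - 1) := by
  have h : ∀ S ∈ W.powersetCard k,
      (S.filter p).card = ((W.filter p).bipartiteAbove (fun S a => a ∈ S) S).card := by
    intro S hS
    congr 1
    ext a
    have := @(Finset.mem_powersetCard.1 hS).1 a
    simp only [Finset.bipartiteAbove, Finset.mem_filter]
    tauto
  rw [Finset.sum_congr rfl h, Finset.sum_card_bipartiteAbove_eq_sum_card_bipartiteBelow,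
    Finset.sum_const_nat]
  intro a ha
  have haW : {a} ⊆ W := Finset.singleton_subset_iff.2 (Finset.mem_filter.1 ha).1
  have := Finset.card_filter_powersetCard_subset {a} W k haW (by simpa using hk)
  simpa [Finset.bipartiteBelow] using this

/-- Under the uniform wedge sampling model, the output `ω·Λ/(3k)` of the
`WedgeSample` algorithm is an unbiased estimator of the triangle count: `E(ω·Λ/(3k)) = Δ`. -/
theorem wedgesample_unbiased
    {V : Type*} [Fintype V] (G : SimpleGraph V) (k : ℕ)
    (hΛ : 1 ≤ (wedgeFinset G).card)
    (hk1 : 1 ≤ k) (hkΛ : k ≤ (wedgeFinset G).card) :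
    wexp G k (fun S =>
        (closedCount G S : ℝ) * ((wedgeFinset G).card : ℝ) / (3 * (k : ℝ)))
      = (triangleCount G : ℝ) := by
  have hsum := sum_card_filter_powersetCard (wedgeFinset G) (IsClosedWedge G) hk1
  have hclosed : ((wedgeFinset G).filter (IsClosedWedge G)).card = 3 * triangleCount G :=
    closedCount_wedgeFinset G
  rw [hclosed] at hsum
  have hchoose := Nat.add_one_mul_choose_eq ((wedgeFinset G).card - 1) (k - 1)
  rw [Nat.sub_add_cancel hΛ, Nat.sub_add_cancel hk1] at hchoose
  have hpos : ((wedgeFinset G).card.choose k : ℝ) ≠ 0 := by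
    exact_mod_cast (Nat.choose_pos hkΛ).ne'
  have hk : (k : ℝ) ≠ 0 := by exact_mod_cast (Nat.one_le_iff_ne_zero.1 hk1)
  have hsum' : ∑ S ∈ (wedgeFinset G).powersetCard k, (closedCount G S : ℝ) =
      3 * triangleCount G * ((wedgeFinset G).card - 1).choose (k - 1) := by
    exact_mod_cast hsum
  have hchoose' : ((wedgeFinset G).card : ℝ) * ((wedgeFinset G).card - 1).choose (k - 1) =
      (wedgeFinset G).card.choose k * k := by
    exact_mod_cast hchoose
  rw [wexp, ← Finset.sum_div, ← Finset.sum_mul, hsum', Finset.card_powersetCard,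
    div_div, div_eq_iff (by positivity)]
  linear_combination 3 * (triangleCount G : ℝ) * hchoose'

end
end
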